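/- Let N ≥ 1 with N ≢ 1 (mod 3), and set n = ⌈N/3⌉ and j = e^{2iπ/3}. Then the characteristic polynomial of the complex transfer matrix 𝕃_N equals X^{F_{N+1}−2ⁿ} · (X−1)^{(2ⁿ+2(−1)ⁿ)/3} · (X−j)^{(2ⁿ−(−1)ⁿ)/3} · (X−j²)^{(2ⁿ−(−1)ⁿ)/3}. In other words, 𝕃_N has eigenvalue 0 with multiplicity F_{N+1}−2ⁿ, eigenvalue 1 with multiplicity (2ⁿ+2(−1)ⁿ)/3, and eigenvalues j and j² each with multiplicity (2ⁿ−(−1)ⁿ)/3. -/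

import Mathlib

open Polynomial

/-- The Fibonacci numbers with the convention `F 0 = F 1 = 1`. -/
def F (n : ℕ) : ℕ := Nat.fib (n + 1)

/-- The index set of the transfer matrix: subsets of `{1,…,N}` containing no two
consecutive integers (independent sets of a path with `N` vertices), encoded as
subsets `C` of `Fin N`, where `k : Fin N` represents the integer `k + 1`. -/
abbrev PathIndep (N : ℕ) :=
  {C : Finset (Fin N) // ∀ c ∈ C, ∀ d ∈ C, (c : ℕ) ≠ (d : ℕ) + 1}

/-- The transfer matrix `𝕃_N`, of size `F_{N+1}`, with rows and columns indexed by the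
subsets of `{1,…,N}` with no two consecutive elements: the entry in row `C` and column
`D` is `i^(|C|+|D|)` if `C ∩ (D+1) = ∅` (no element of `C` equals an element of `D`
plus one), and `0` otherwise. -/
def Lmat (N : ℕ) : Matrix (PathIndep N) (PathIndep N) ℂ :=
  fun C D =>
    if ∀ c ∈ C.1, ∀ d ∈ D.1, (c : ℕ) ≠ (d : ℕ) + 1
    then Complex.I ^ (C.1.card + D.1.card) else 0


theorem charpoly_block_aux {ι : Type*} [Fintype ι] [DecidableEq ι] (L : Matrix ι ι ℂ)
    (p : ι → Prop) [DecidablePred p]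
    (h1 : ∀ c e, ¬ p c → ∑ d, (if p d then L c d * L d e else 0) = 0)
    (h2 : ∀ c e, ¬ p c → ∑ d, (if p d then 0 else L c d * L d e) = 0) :
    L.charpoly = (L.toBlock p p).charpoly * X ^ Fintype.card {a // ¬ p a} := by
  obtain ⟨Q, hQ⟩ : ∃ Q : Matrix ι ι ℂ, ∀ c d, Q c d = if p c then 0 else L c d :=
    ⟨fun c d => if p c then 0 else L c d, fun _ _ => rfl⟩
  obtain ⟨P, hP⟩ : ∃ P : Matrix ι ι ℂ, ∀ c d, P c d = if p c then L c d else 0 :=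
    ⟨fun c d => if p c then L c d else 0, fun _ _ => rfl⟩
  have hLPQ : L = P + Q := by
    ext c d; simp only [hQ, hP, Matrix.add_apply]; split_ifs <;> simp
  have hQQ : Q * Q = 0 := by
    ext c e
    simp only [Matrix.mul_apply, hQ, Matrix.zero_apply]
    by_cases hc : p c
    · simp [hc]
    · refine Eq.trans (Finset.sum_congr rfl fun d _ => ?_) (h2 c e hc)
      simp [hc]
  have hQP : Q * P = 0 := by
    ext c e
    simp only [Matrix.mul_apply, hQ, hP, Matrix.zero_apply]
    by_cases hc : p c
    · simp [hc]
    · refine Eq.trans (Finset.sum_congr rfl fun d _ => ?_) (h1 c e hc)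
      simp [hc]
  have hnil : (-Q).charpoly = X ^ Fintype.card ι := by
    have : IsNilpotent (-Q) := ⟨2, by rw [pow_two, neg_mul_neg, hQQ]⟩
    have h := Matrix.isNilpotent_charpoly_sub_pow_of_isNilpotent this
    exact sub_eq_zero.mp h.eq_zero
  have h3 : X ^ Fintype.card ι * L.charpoly = X ^ Fintype.card ι * P.charpoly := by
    nth_rewrite 1 [← hnil]
    refine Polynomial.funext fun z => ?_
    rw [eval_mul, eval_mul, Matrix.eval_charpoly, Matrix.eval_charpoly, Matrix.eval_charpoly,
      ← Matrix.det_mul, eval_pow, eval_X, ← Matrix.det_smul]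
    congr 1
    have hs : (Matrix.scalar ι) z = z • (1 : Matrix ι ι ℂ) := by
      rw [Matrix.smul_one_eq_diagonal]; rfl
    rw [hs, hLPQ]
    simp only [sub_neg_eq_add, add_mul, mul_sub, mul_add, hQQ, hQP, smul_mul_assoc, one_mul,
      mul_smul_comm, mul_one, smul_sub]
    simp only [smul_add]
    abel
  have h4 : L.charpoly = P.charpoly :=
    mul_left_cancel₀ (pow_ne_zero _ X_ne_zero) h3
  rw [h4, ← Matrix.charpoly_reindex (Equiv.sumCompl p).symm P]
  have : (Matrix.reindex (Equiv.sumCompl p).symm (Equiv.sumCompl p).symm) P =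
      Matrix.fromBlocks (L.toBlock p p) (L.toBlock p (fun a => ¬ p a)) 0 0 := by
    ext i j
    rcases i with i | i <;> rcases j with j | j <;>
      simp [hP, Matrix.toBlock, i.2]
  rw [this, Matrix.charpoly_fromBlocks_zero₂₁, Matrix.charpoly_zero]

open Matrix in
theorem charpoly_of_similar {ι : Type*} [Fintype ι] [DecidableEq ι] (A B P : Matrix ι ι ℂ)
    (hP : P.det ≠ 0) (h : A * P = P * B) : A.charpoly = B.charpoly := by
  refine Polynomial.funext fun z => ?_
  rw [Matrix.eval_charpoly, Matrix.eval_charpoly]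
  have : (Matrix.scalar ι z - A) * P = P * (Matrix.scalar ι z - B) := by
    rw [sub_mul, mul_sub, h, (Matrix.scalar_commute z (fun r => mul_comm _ _) P).eq]
  have h2 := congrArg Matrix.det this
  rw [det_mul, det_mul, mul_comm] at h2
  exact mul_left_cancel₀ hP h2

open Matrix Kronecker in
theorem charpoly_kron_aux {m k : Type*} [Fintype m] [DecidableEq m] [Fintype k] [DecidableEq k]
    (A : Matrix m m ℂ) (M P : Matrix k k ℂ) (d : k → ℂ) (hP : P.det ≠ 0)
    (h : M * P = P * Matrix.diagonal d) :
    (M ⊗ₖ A).charpoly = ∏ i, (d i • A).charpoly := by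
  have h1 : (M ⊗ₖ A).charpoly = (Matrix.diagonal d ⊗ₖ A).charpoly := by
    refine charpoly_of_similar _ _ (P ⊗ₖ (1 : Matrix m m ℂ)) ?_ ?_
    · rw [Matrix.det_kronecker]; simp [hP]
    · rw [← Matrix.mul_kronecker_mul, ← Matrix.mul_kronecker_mul, h, mul_one, one_mul]
  rw [h1, Matrix.diagonal_kronecker, Matrix.charpoly_reindex]
  refine Polynomial.funext fun z => ?_
  rw [Matrix.eval_charpoly, eval_prod]
  have : Matrix.scalar (m × k) z - Matrix.blockDiagonal (fun i => d i • A) =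
      Matrix.blockDiagonal (fun i => Matrix.scalar m z - d i • A) := by
    have h0 : Matrix.scalar (m × k) z = Matrix.blockDiagonal (fun _ => Matrix.scalar m z) := by
      simp [Matrix.scalar_apply]
    rw [h0, ← Matrix.blockDiagonal_sub]; rfl
  rw [this, Matrix.det_blockDiagonal]
  simp only [Matrix.eval_charpoly]

theorem charpoly_smul_aux {m κ : Type*} [Fintype m] [DecidableEq m] [Fintype κ]
    (A : Matrix m m ℂ) (r : κ → ℂ) (e : κ → ℕ) (c : ℂ) (hc : c ≠ 0)
    (h : A.charpoly = ∏ i, (X - C (r i)) ^ e i) :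
    (c • A).charpoly = ∏ i, (X - C (c * r i)) ^ e i := by
  have hd : Fintype.card m = ∑ i, e i := by
    rw [← Matrix.charpoly_natDegree_eq_dim A, h, natDegree_prod_of_monic]
    · simp
    · intro i _; exact (monic_X_sub_C _).pow _
  refine Polynomial.funext fun z => ?_
  have h0 : Matrix.scalar m z - c • A = c • (Matrix.scalar m (z / c) - A) := by
    rw [smul_sub]; congr 1
    ext i j
    by_cases hij : i = j
    · subst hij; simp; field_simp
    · simp [hij]
  rw [Matrix.eval_charpoly, h0, Matrix.det_smul, ← Matrix.eval_charpoly, h, hd, eval_prod, eval_prod,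
    ← Finset.prod_pow_eq_pow_sum, ← Finset.prod_mul_distrib]
  refine Finset.prod_congr rfl fun i _ => ?_
  simp only [eval_pow, eval_sub, eval_X, eval_C]
  rw [← mul_pow]; congr 1
  field_simp

theorem charpoly_kron_final {m : Type*} [Fintype m] [DecidableEq m]
    (A : Matrix m m ℂ) (j : ℂ) (hj : IsPrimitiveRoot j 3) (e a b : ℕ)
    (h : A.charpoly = X ^ e * (X - C 1) ^ a * (X - C j) ^ b * (X - C (j ^ 2)) ^ b) :
    (Matrix.kroneckerMap (· * ·)
      !![1, Complex.I, Complex.I; Complex.I, -1, -1; Complex.I, 0, -1] A).charpoly =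
      X ^ (Fintype.card m + 2 * e) * (X - C 1) ^ (2 * b) * (X - C j) ^ (a + b)
       * (X - C (j ^ 2)) ^ (a + b) := by
  have hj3 : j ^ 3 = 1 := hj.pow_eq_one
  have hj1 : j ≠ 1 := hj.ne_one (by norm_num)
  have hj0 : j ≠ 0 := hj.ne_zero (by norm_num)
  have hjs : 1 + j + j ^ 2 = 0 := by
    have : (j - 1) * (1 + j + j ^ 2) = 0 := by linear_combination hj3
    exact (mul_eq_zero.mp this).resolve_left (sub_ne_zero.mpr hj1)
  have hI : Complex.I ^ 2 = -1 := Complex.I_sq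
  have hA : A.charpoly = ∏ i, (X - C ((![0, 1, j, j ^ 2] : Fin 4 → ℂ) i)) ^
      (![e, a, b, b] : Fin 4 → ℕ) i := by
    rw [h, Fin.prod_univ_four]; simp
  rw [charpoly_kron_aux A _
    !![1, 1 + j, 1 + j ^ 2; 0, -Complex.I * j ^ 2, -Complex.I * j;
      Complex.I, Complex.I, Complex.I] ![0, j, j ^ 2] ?_ ?_, Fin.prod_univ_three]
  · have e1 := charpoly_smul_aux A _ _ j hj0 hA
    have e2 := charpoly_smul_aux A _ _ (j ^ 2) (pow_ne_zero 2 hj0) hA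
    have t1 : j * j ^ 2 = 1 := by linear_combination hj3
    have t2 : j ^ 2 * j = 1 := by linear_combination hj3
    have t3 : j ^ 2 * j ^ 2 = j := by linear_combination j * hj3
    have t4 : j * j = j ^ 2 := by ring
    rw [Fin.prod_univ_four] at e1 e2
    simp only [Matrix.cons_val, mul_zero, mul_one, t1, t2, t3, t4] at e1 e2
    simp only [Matrix.cons_val, zero_smul, Matrix.charpoly_zero, e1, e2, C_0, sub_zero]
    ring
  · rw [Matrix.det_fin_three]
    simp only [Matrix.of_apply, Matrix.cons_val]
    have : j * (j - 1) ≠ 0 := mul_ne_zero hj0 (sub_ne_zero.mpr hj1)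
    intro h0
    apply this
    linear_combination h0 - (j ^ 4 - j ^ 2) * hI + j * hj3
  · ext i k
    fin_cases i <;> fin_cases k <;> 
      simp [Matrix.mul_apply, Fin.sum_univ_three]
    · linear_combination -(j ^ 2) * hI
    · linear_combination -j * hI - j * hj3
    · linear_combination Complex.I * j * hjs
    · linear_combination Complex.I * j * hjs
    · ring
    · ring
/-- Toggling membership of `0` in an independent set not containing `1`. -/
def toggleSet {N : ℕ} (D : Finset (Fin (N + 3))) : Finset (Fin (N + 3)) :=
  if (1 : Fin (N + 3)) ∈ D then D else if (0 : Fin (N + 3)) ∈ D then D.erase 0 else insert 0 D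

theorem val_one_aux {N : ℕ} : ((1 : Fin (N + 3)) : ℕ) = 1 := by
  rw [Fin.val_one']; exact Nat.mod_eq_of_lt (by omega)

theorem val_two_aux {N : ℕ} : ((2 : Fin (N + 3)) : ℕ) = 2 := by
  have h : ((2 : Fin (N + 3)) : ℕ) = 2 % (N + 3) := rfl
  rw [h]; exact Nat.mod_eq_of_lt (by omega)

theorem eq_one_aux {N : ℕ} {c : Fin (N + 3)} (h : (c : ℕ) = 1) : c = 1 :=
  Fin.ext (h.trans val_one_aux.symm)

theorem eq_two_aux {N : ℕ} {c : Fin (N + 3)} (h : (c : ℕ) = 2) : c = 2 :=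
  Fin.ext (h.trans val_two_aux.symm)

theorem one_ne_zero_aux {N : ℕ} : (1 : Fin (N + 3)) ≠ 0 := by
  intro h; have := congrArg Fin.val h; rw [val_one_aux] at this; simp at this

theorem two_ne_zero_aux {N : ℕ} : (2 : Fin (N + 3)) ≠ 0 := by
  intro h; have := congrArg Fin.val h; rw [val_two_aux] at this; simp at this

theorem toggle_indep {N : ℕ} (D : PathIndep (N + 3)) :
    ∀ c ∈ toggleSet D.1, ∀ d ∈ toggleSet D.1, (c : ℕ) ≠ (d : ℕ) + 1 := by
  have h := D.2
  unfold toggleSet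
  split_ifs with h1 h0
  · exact h
  · intro c hc d hd
    exact h c (Finset.mem_of_mem_erase hc) d (Finset.mem_of_mem_erase hd)
  · intro c hc d hd
    rw [Finset.mem_insert] at hc hd
    rcases hc with rfl | hc
    · simp
    · rcases hd with rfl | hd
      · intro h2
        have : c = 1 := eq_one_aux (by simpa using h2)
        exact h1 (this ▸ hc)
      · exact h c hc d hd

/-- Toggling as a map on independent sets. -/
def toggle {N : ℕ} (D : PathIndep (N + 3)) : PathIndep (N + 3) := ⟨toggleSet D.1, toggle_indep D⟩

theorem toggleSet_invol {N : ℕ} (D : Finset (Fin (N + 3))) : toggleSet (toggleSet D) = D := by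
  have h01 := @one_ne_zero_aux N
  by_cases h1 : (1 : Fin (N + 3)) ∈ D
  · simp [toggleSet, h1]
  · by_cases h0 : (0 : Fin (N + 3)) ∈ D
    · have : toggleSet D = D.erase 0 := by simp [toggleSet, h1, h0]
      rw [this]; simp [toggleSet, h1, Finset.insert_erase h0]
    · have : toggleSet D = insert 0 D := by simp [toggleSet, h1, h0]
      rw [this]; simp [toggleSet, h1, h0, h01]

theorem two_mem_toggle {N : ℕ} (D : Finset (Fin (N + 3))) :
    (2 : Fin (N + 3)) ∈ toggleSet D ↔ (2 : Fin (N + 3)) ∈ D := by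
  have := @two_ne_zero_aux N
  unfold toggleSet; split_ifs <;> simp [this]

theorem Lmat_insert_right {N : ℕ} (C D D' : PathIndep (N + 3)) (hC : (2 : Fin (N + 3)) ∈ C.1)
    (h0 : (0 : Fin (N + 3)) ∉ D.1) (hD : D'.1 = insert 0 D.1) :
    Lmat (N + 3) C D' = Complex.I * Lmat (N + 3) C D := by
  have h1C : (1 : Fin (N + 3)) ∉ C.1 := fun h =>
    C.2 2 hC 1 h (by rw [val_one_aux, val_two_aux])
  have hiff : (∀ c ∈ C.1, ∀ d ∈ D'.1, (c : ℕ) ≠ (d : ℕ) + 1) ↔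
      (∀ c ∈ C.1, ∀ d ∈ D.1, (c : ℕ) ≠ (d : ℕ) + 1) := by
    rw [hD]
    constructor
    · intro h c hc d hd
      exact h c hc d (Finset.mem_insert_of_mem hd)
    · intro h c hc d hd
      rcases Finset.mem_insert.mp hd with rfl | hd
      · intro h2
        have : c = 1 := eq_one_aux (by simpa using h2)
        exact h1C (this ▸ hc)
      · exact h c hc d hd
  unfold Lmat
  simp only [hiff]
  have hcard : D'.1.card = D.1.card + 1 := by rw [hD, Finset.card_insert_of_notMem h0]
  rw [hcard]
  split_ifs
  · ring
  · simp

theorem Lmat_insert_left {N : ℕ} (D D' E : PathIndep (N + 3))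
    (h0 : (0 : Fin (N + 3)) ∉ D.1) (hD : D'.1 = insert 0 D.1) :
    Lmat (N + 3) D' E = Complex.I * Lmat (N + 3) D E := by
  have hiff : (∀ c ∈ D'.1, ∀ d ∈ E.1, (c : ℕ) ≠ (d : ℕ) + 1) ↔
      (∀ c ∈ D.1, ∀ d ∈ E.1, (c : ℕ) ≠ (d : ℕ) + 1) := by
    rw [hD]
    constructor
    · intro h c hc d hd
      exact h c (Finset.mem_insert_of_mem hc) d hd
    · intro h c hc d hd
      rcases Finset.mem_insert.mp hc with rfl | hc
      · simp
      · exact h c hc d hd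
  unfold Lmat
  simp only [hiff]
  have hcard : D'.1.card = D.1.card + 1 := by rw [hD, Finset.card_insert_of_notMem h0]
  rw [hcard]
  split_ifs
  · ring
  · simp

theorem Lmat_toggle {N : ℕ} (C D E : PathIndep (N + 3)) (hC : (2 : Fin (N + 3)) ∈ C.1) :
    Lmat (N + 3) C D * Lmat (N + 3) D E +
      Lmat (N + 3) C (toggle D) * Lmat (N + 3) (toggle D) E = 0 := by
  have hI : Complex.I * Complex.I = -1 := Complex.I_mul_I
  by_cases h1 : (1 : Fin (N + 3)) ∈ D.1
  · have hz : ∀ D : PathIndep (N + 3), (1 : Fin (N + 3)) ∈ D.1 → Lmat (N + 3) C D = 0 := by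
      intro D h1
      unfold Lmat
      rw [if_neg]
      intro h
      exact h 2 hC 1 h1 (by rw [val_one_aux, val_two_aux])
    rw [hz D h1, hz (toggle D) (by simp [toggle, toggleSet, h1])]
    simp
  · by_cases h0 : (0 : Fin (N + 3)) ∈ D.1
    · have ht : (toggle D).1 = D.1.erase 0 := by simp [toggle, toggleSet, h1, h0]
      have ht0 : (0 : Fin (N + 3)) ∉ (toggle D).1 := by rw [ht]; simp
      have ht' : D.1 = insert 0 (toggle D).1 := by rw [ht, Finset.insert_erase h0]
      rw [Lmat_insert_right C _ _ hC ht0 ht', Lmat_insert_left _ _ E ht0 ht']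
      linear_combination (Lmat (N + 3) C (toggle D) * Lmat (N + 3) (toggle D) E) * hI
    · have ht : (toggle D).1 = insert 0 D.1 := by simp [toggle, toggleSet, h1, h0]
      rw [Lmat_insert_right C _ _ hC h0 ht, Lmat_insert_left _ _ E h0 ht]
      linear_combination (Lmat (N + 3) C D * Lmat (N + 3) D E) * hI

theorem Lmat_sum_zero {N : ℕ} (C E : PathIndep (N + 3)) (hC : (2 : Fin (N + 3)) ∈ C.1)
    (p : PathIndep (N + 3) → Prop) [DecidablePred p] (hp : ∀ D, p (toggle D) ↔ p D) :
    ∑ D, (if p D then Lmat (N + 3) C D * Lmat (N + 3) D E else 0) = 0 := by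
  refine Finset.sum_involution (fun D _ => toggle D) ?_ ?_ ?_ ?_
  · intro D _
    simp only [hp]
    split_ifs
    · exact Lmat_toggle C D E hC
    · simp
  · intro D _ hne heq
    have h := Lmat_toggle C D E hC
    rw [heq] at h
    apply hne
    have h' : Lmat (N + 3) C D * Lmat (N + 3) D E = 0 := by
      linear_combination h / 2
    simp [h']
  · intro D _; exact Finset.mem_univ _
  · intro D _
    exact Subtype.ext (toggleSet_invol D.1)

/-- The set `{0}`, `{1}` or `∅` followed by a shifted copy of `B`. -/
def joinSet {N : ℕ} (k : Fin 3) (B : Finset (Fin N)) : Finset (Fin (N + 3)) :=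
  (if k = 1 then {0} else if k = 2 then {1} else ∅) ∪ B.map (Fin.addNatEmb 3)

theorem mem_joinSet {N : ℕ} (k : Fin 3) (B : Finset (Fin N)) (x : Fin (N + 3)) :
    x ∈ joinSet k B ↔ ((x : ℕ) = 0 ∧ k = 1) ∨ ((x : ℕ) = 1 ∧ k = 2) ∨
      ∃ i ∈ B, (x : ℕ) = (i : ℕ) + 3 := by
  have hx0 : x = 0 ↔ (x : ℕ) = 0 :=
    ⟨fun h => by simp [h], fun h => Fin.ext (by simpa using h)⟩
  have hx1 : x = 1 ↔ (x : ℕ) = 1 := by rw [Fin.ext_iff, val_one_aux]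
  have hm : x ∈ B.map (Fin.addNatEmb 3) ↔ ∃ i ∈ B, (x : ℕ) = (i : ℕ) + 3 := by
    simp only [Finset.mem_map, Fin.ext_iff]
    constructor
    · rintro ⟨i, hi, h⟩; exact ⟨i, hi, h.symm⟩
    · rintro ⟨i, hi, h⟩; exact ⟨i, hi, h.symm⟩
  unfold joinSet
  rw [Finset.mem_union, hm, ← hx0, ← hx1]
  fin_cases k <;> simp

theorem card_joinSet {N : ℕ} (k : Fin 3) (B : Finset (Fin N)) :
    (joinSet k B).card = (if k = 0 then 0 else 1) + B.card := by
  unfold joinSet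
  rw [Finset.card_union_of_disjoint, Finset.card_map]
  · fin_cases k <;> simp
  · rw [Finset.disjoint_left]
    intro x hx hx'
    obtain ⟨i, hi, rfl⟩ := Finset.mem_map.mp hx'
    have h3 : ((Fin.addNatEmb 3 i : Fin (N + 3)) : ℕ) = i + 3 := rfl
    have := @val_one_aux N
    fin_cases k
    · simp at hx
    · simp only [Fin.mk_one, if_true, Finset.mem_singleton] at hx
      rw [hx] at h3; simp at h3
    · simp at hx
      have h4 := congrArg Fin.val hx
      rw [this] at h4; simp at h4

theorem join_cond {N : ℕ} (k l : Fin 3) (B D : Finset (Fin N)) :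
    (∀ c ∈ joinSet k B, ∀ d ∈ joinSet l D, (c : ℕ) ≠ (d : ℕ) + 1) ↔
      ¬ (k = 2 ∧ l = 1) ∧ ∀ c ∈ B, ∀ d ∈ D, (c : ℕ) ≠ (d : ℕ) + 1 := by
  simp only [mem_joinSet]
  constructor
  · intro h
    constructor
    · rintro ⟨hk, hl⟩
      exact h 1 (Or.inr (Or.inl ⟨val_one_aux, hk⟩)) 0 (Or.inl ⟨by simp, hl⟩)
        (by rw [val_one_aux]; simp)
    · intro c hc d hd hcd
      refine h (c.addNat 3) (Or.inr (Or.inr ⟨c, hc, by simp⟩)) (d.addNat 3)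
        (Or.inr (Or.inr ⟨d, hd, by simp⟩)) ?_
      simp only [Fin.val_addNat]; omega
  · rintro ⟨hkl, h⟩ c hc d hd hcd
    rcases hc with ⟨hc, hk⟩ | ⟨hc, hk⟩ | ⟨i, hi, hc⟩
    · omega
    · rcases hd with ⟨hd, hl⟩ | ⟨hd, hl⟩ | ⟨i', hi', hd⟩
      · exact hkl ⟨hk, hl⟩
      · omega
      · omega
    · rcases hd with ⟨hd, hl⟩ | ⟨hd, hl⟩ | ⟨i', hi', hd⟩
      · omega
      · omega
      · exact h i hi i' hi' (by omega)

/-- Joining as a map into the independent sets not containing `2`. -/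
def joinMap {N : ℕ} (x : Fin 3 × PathIndep N) :
    {C : PathIndep (N + 3) // (2 : Fin (N + 3)) ∉ C.1} :=
  ⟨⟨joinSet x.1 x.2.1, (join_cond _ _ _ _).mpr ⟨by rintro ⟨h1, h2⟩; simp [h1] at h2, x.2.2⟩⟩, by
    simp only [mem_joinSet, val_two_aux]
    rintro (h | h | ⟨i, hi, h⟩) <;> omega⟩

theorem joinMap_bijective {N : ℕ} : Function.Bijective (@joinMap N) := by
  constructor
  · rintro ⟨k, B⟩ ⟨l, D⟩ h
    have h' : joinSet k B.1 = joinSet l D.1 := congrArg (fun z => z.1.1) h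
    have hm : ∀ x, x ∈ joinSet k B.1 ↔ x ∈ joinSet l D.1 := fun x => by rw [h']
    simp only [mem_joinSet] at hm
    have hB : B = D := by
      apply Subtype.ext
      ext i
      have := hm (i.addNat 3)
      simp only [Fin.val_addNat] at this
      simpa [Fin.val_inj] using this
    have h0 := hm 0
    have h1 := hm 1
    rw [val_one_aux] at h1
    simp at h0 h1
    have hk : k = l := by omega
    rw [hk, hB]
  · rintro ⟨⟨C, hC⟩, h2⟩
    let k : Fin 3 := if (0 : Fin (N + 3)) ∈ C then 1 else if (1 : Fin (N + 3)) ∈ C then 2 else 0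
    refine ⟨⟨k, ⟨Finset.univ.filter (fun i => i.addNat 3 ∈ C), ?_⟩⟩, ?_⟩
    · intro c hc d hd hcd
      simp at hc hd
      exact hC _ hc _ hd (by simp only [Fin.val_addNat]; omega)
    · apply Subtype.ext; apply Subtype.ext
      ext x
      simp only [joinMap, mem_joinSet, Finset.mem_filter, Finset.mem_univ, true_and]
      have h01 : ¬ ((0 : Fin (N + 3)) ∈ C ∧ (1 : Fin (N + 3)) ∈ C) := by
        rintro ⟨ha, hb⟩
        exact hC 1 hb 0 ha (by rw [val_one_aux]; simp)
      have hk1 : k = 1 ↔ (0 : Fin (N + 3)) ∈ C := by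
        simp only [k]; split_ifs <;> simp_all
      have hk2 : k = 2 ↔ (1 : Fin (N + 3)) ∈ C := by
        simp only [k]; split_ifs <;> simp_all
      rw [hk1, hk2]
      constructor
      · rintro (⟨hx, h⟩ | ⟨hx, h⟩ | ⟨i, hi, hx⟩)
        · have : x = 0 := Fin.ext (by simpa using hx)
          rwa [this]
        · rwa [eq_one_aux hx]
        · have : x = i.addNat 3 := Fin.ext (by simpa using hx)
          rwa [this]
      · intro hx
        by_cases hx0 : (x : ℕ) = 0
        · have : x = 0 := Fin.ext (by simpa using hx0)
          left; exact ⟨hx0, this ▸ hx⟩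
        by_cases hx1 : (x : ℕ) = 1
        · right; left; exact ⟨hx1, eq_one_aux hx1 ▸ hx⟩
        by_cases hx2 : (x : ℕ) = 2
        · exact absurd (eq_two_aux hx2 ▸ hx) h2
        · right; right
          refine ⟨⟨x - 3, by omega⟩, ?_, by simp; omega⟩
          have : Fin.addNat (⟨x - 3, by omega⟩ : Fin N) 3 = x := Fin.ext (by simp; omega)
          rwa [this]

theorem Lmat_join {N : ℕ} (k l : Fin 3) (B D : PathIndep N) :
    Lmat (N + 3) (joinMap (k, B)).1 (joinMap (l, D)).1 =
      (!![1, Complex.I, Complex.I; Complex.I, -1, -1; Complex.I, 0, -1] : Matrix (Fin 3) (Fin 3) ℂ)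
        k l * Lmat N B D := by
  have hI : Complex.I * Complex.I = -1 := Complex.I_mul_I
  simp only [Lmat, joinMap, join_cond, card_joinSet]
  by_cases h : ∀ c ∈ B.1, ∀ d ∈ D.1, (c : ℕ) ≠ (d : ℕ) + 1
  · fin_cases k <;> fin_cases l <;> simp [h] <;> ring_nf <;> simp
  · simp only [h, and_false, if_false, mul_zero]

theorem Lmat_step (N : ℕ) (j : ℂ) (hj : IsPrimitiveRoot j 3) (e a b : ℕ)
    (h : (Lmat N).charpoly = X ^ e * (X - C 1) ^ a * (X - C j) ^ b * (X - C (j ^ 2)) ^ b) :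
    ∃ e', (Lmat (N + 3)).charpoly =
      X ^ e' * (X - C 1) ^ (2 * b) * (X - C j) ^ (a + b) * (X - C (j ^ 2)) ^ (a + b) := by
  have hblock := charpoly_block_aux (Lmat (N + 3)) (fun C => (2 : Fin (N + 3)) ∉ C.1)
    (fun c e hc => Lmat_sum_zero c e (not_not.mp hc) (fun C => (2 : Fin (N + 3)) ∉ C.1)
      (fun D => not_congr (two_mem_toggle D.1)))
    (fun c e hc => by
      have := Lmat_sum_zero c e (not_not.mp hc) (fun C => (2 : Fin (N + 3)) ∈ C.1)
        (fun D => two_mem_toggle D.1)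
      refine Eq.trans (Finset.sum_congr rfl fun D _ => ?_) this
      by_cases hD : (2 : Fin (N + 3)) ∈ D.1 <;> simp [hD])
  have hkron := charpoly_kron_final (Lmat N) j hj e a b h
  have hre : (Lmat (N + 3)).toBlock (fun C => (2 : Fin (N + 3)) ∉ C.1)
      (fun C => (2 : Fin (N + 3)) ∉ C.1) =
      Matrix.reindex (Equiv.ofBijective _ (@joinMap_bijective N))
        (Equiv.ofBijective _ (@joinMap_bijective N))
        (Matrix.kroneckerMap (· * ·)
          !![1, Complex.I, Complex.I; Complex.I, -1, -1; Complex.I, 0, -1] (Lmat N)) := by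
    ext x y
    obtain ⟨⟨k, B⟩, rfl⟩ := (Equiv.ofBijective _ (@joinMap_bijective N)).surjective x
    obtain ⟨⟨l, D⟩, rfl⟩ := (Equiv.ofBijective _ (@joinMap_bijective N)).surjective y
    rw [Matrix.reindex_apply, Matrix.submatrix_apply, Equiv.symm_apply_apply,
      Equiv.symm_apply_apply, Matrix.kroneckerMap_apply, ← Lmat_join]
    rfl
  rw [hre, Matrix.charpoly_reindex, hkron] at hblock
  exact ⟨_, by rw [hblock, mul_comm, ← mul_assoc, ← mul_assoc, ← mul_assoc, ← pow_add]⟩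


theorem card_pathIndep_rec (N : ℕ) :
    Fintype.card (PathIndep (N + 2)) =
      Fintype.card (PathIndep (N + 1)) + Fintype.card (PathIndep N) := by
  have key : ∀ M, Fintype.card (PathIndep M) = ((Finset.range M).powerset.filter
      (fun C => ∀ c ∈ C, ∀ d ∈ C, c ≠ d + 1)).card := by
    intro M
    rw [Fintype.card_subtype]
    refine Finset.card_bij (fun C _ => C.map Fin.valEmbedding) ?_ ?_ ?_
    · intro C hC
      simp only [Finset.mem_filter, Finset.mem_univ, true_and] at hC
      simp only [Finset.mem_filter, Finset.mem_powerset]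
      constructor
      · intro x hx
        obtain ⟨i, _, rfl⟩ := Finset.mem_map.mp hx
        exact Finset.mem_range.mpr i.2
      · intro c hc d hd
        obtain ⟨i, hi, rfl⟩ := Finset.mem_map.mp hc
        obtain ⟨i', hi', rfl⟩ := Finset.mem_map.mp hd
        exact hC i hi i' hi'
    · intro C _ D _ h
      exact Finset.map_injective _ h
    · intro S hS
      simp only [Finset.mem_filter, Finset.mem_powerset] at hS
      refine ⟨Finset.univ.filter (fun i => (i : ℕ) ∈ S), ?_, ?_⟩
      · simp only [Finset.mem_filter, Finset.mem_univ, true_and]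
        intro c hc d hd
        exact hS.2 _ hc _ hd
      · ext x
        simp only [Finset.mem_map, Finset.mem_filter, Finset.mem_univ, true_and]
        constructor
        · rintro ⟨i, hi, rfl⟩; exact hi
        · intro hx
          exact ⟨⟨x, Finset.mem_range.mp (hS.1 hx)⟩, hx, rfl⟩
  rw [key, key, key]
  rw [← Finset.card_filter_add_card_filter_not (p := fun C => N + 1 ∉ C)]
  congr 1
  · congr 1
    ext S
    simp only [Finset.mem_filter, Finset.mem_powerset]
    constructor
    · rintro ⟨⟨h1, h2⟩, h3⟩
      refine ⟨fun x hx => ?_, h2⟩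
      have := Finset.mem_range.mp (h1 hx)
      have h4 : x ≠ N + 1 := fun h => h3 (h ▸ hx)
      exact Finset.mem_range.mpr (by omega)
    · rintro ⟨h1, h2⟩
      refine ⟨⟨fun x hx => ?_, h2⟩, fun h => ?_⟩
      · have := Finset.mem_range.mp (h1 hx)
        exact Finset.mem_range.mpr (by omega)
      · have := Finset.mem_range.mp (h1 h)
        omega
  · refine Finset.card_bij' (fun S _ => S.erase (N + 1)) (fun S _ => insert (N + 1) S) ?_ ?_ ?_ ?_
    · intro S hS
      simp only [Finset.mem_filter, Finset.mem_powerset, not_not] at hS ⊢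
      obtain ⟨⟨h1, h2⟩, h3⟩ := hS
      refine ⟨fun x hx => ?_, fun c hc d hd =>
        h2 c (Finset.mem_of_mem_erase hc) d (Finset.mem_of_mem_erase hd)⟩
      obtain ⟨hx1, hx2⟩ := Finset.mem_erase.mp hx
      have h4 := Finset.mem_range.mp (h1 hx2)
      have h5 := h2 _ h3 _ hx2
      exact Finset.mem_range.mpr (by omega)
    · intro S hS
      simp only [Finset.mem_filter, Finset.mem_powerset, not_not] at hS ⊢
      obtain ⟨h1, h2⟩ := hS
      have h3 : ∀ x ∈ S, x < N := fun x hx => Finset.mem_range.mp (h1 hx)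
      refine ⟨⟨fun x hx => ?_, fun c hc d hd => ?_⟩, Finset.mem_insert_self _ _⟩
      · rcases Finset.mem_insert.mp hx with rfl | hx
        · exact Finset.mem_range.mpr (by omega)
        · have := h3 x hx
          exact Finset.mem_range.mpr (by omega)
      · rcases Finset.mem_insert.mp hc with rfl | hc <;>
          rcases Finset.mem_insert.mp hd with rfl | hd
        · omega
        · have := h3 d hd; omega
        · have := h3 c hc; omega
        · exact h2 c hc d hd
    · intro S hS
      simp only [Finset.mem_filter, not_not] at hS
      exact Finset.insert_erase hS.2
    · intro S hS
      simp only [Finset.mem_filter, Finset.mem_powerset] at hS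
      refine Finset.erase_insert fun h => ?_
      have := Finset.mem_range.mp (hS.1 h)
      omega

theorem card_pathIndep (N : ℕ) : Fintype.card (PathIndep N) = F (N + 1) := by
  induction N using Nat.twoStepInduction with
  | zero => decide
  | one => decide
  | more N h1 h2 =>
    rw [card_pathIndep_rec, h1, h2]
    unfold F
    rw [Nat.fib_add_two (n := N + 2)]
    ring

theorem charpoly_Lmat_zero (j : ℂ) :
    (Lmat 0).charpoly = X ^ 0 * (X - C 1) ^ 1 * (X - C j) ^ 0 * (X - C (j ^ 2)) ^ 0 := by
  have h : Lmat 0 = 1 := by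
    ext x y
    have : x = y := Subsingleton.elim _ _
    subst this
    have h0 : x.1 = ∅ := Subsingleton.elim _ _
    simp [Lmat, h0]
  rw [h, Matrix.charpoly_one, card_pathIndep]
  simp [F]

theorem charpoly_Lmat_two (j : ℂ) (hj : IsPrimitiveRoot j 3) :
    (Lmat 2).charpoly = X ^ 1 * (X - C 1) ^ 0 * (X - C j) ^ 1 * (X - C (j ^ 2)) ^ 1 := by
  have hjs : 1 + j + j ^ 2 = 0 := by
    have : (j - 1) * (1 + j + j ^ 2) = 0 := by linear_combination hj.pow_eq_one
    exact (mul_eq_zero.mp this).resolve_left (sub_ne_zero.mpr (hj.ne_one (by norm_num)))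
  have hj3 := hj.pow_eq_one
  let f : Fin 3 → PathIndep 2 := ![⟨∅, by decide⟩, ⟨{0}, by decide⟩, ⟨{1}, by decide⟩]
  have hf : Function.Bijective f := by decide
  have h := Matrix.charpoly_reindex (Equiv.ofBijective f hf).symm (Lmat 2)
  have hm : Matrix.reindex (Equiv.ofBijective f hf).symm (Equiv.ofBijective f hf).symm (Lmat 2) =
      !![1, Complex.I, Complex.I; Complex.I, -1, -1; Complex.I, 0, -1] := by
    ext k l
    fin_cases k <;> fin_cases l <;> simp [f, Lmat]
  rw [← h, hm]
  refine Polynomial.funext fun z => ?_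
  rw [Matrix.eval_charpoly, Matrix.det_fin_three]
  simp
  have hI : Complex.I * Complex.I = -1 := Complex.I_mul_I
  linear_combination (-z - 1) * hI + z ^ 2 * hjs - z * hj3

theorem Lmat_exists (j : ℂ) (hj : IsPrimitiveRoot j 3) (N : ℕ) (hN3 : N % 3 ≠ 1) :
    ∀ n a b : ℕ, n = (N + 2) / 3 → (3 * a : ℤ) = 2 ^ n + 2 * (-1) ^ n →
      (3 * b : ℤ) = 2 ^ n - (-1) ^ n → ∃ e,
      (Lmat N).charpoly = X ^ e * (X - C 1) ^ a * (X - C j) ^ b * (X - C (j ^ 2)) ^ b := by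
  induction N using Nat.strong_induction_on with
  | _ N ih =>
    intro n a b hn ha hb
    match N, ih, hN3, hn with
    | 0, _, _, hn =>
      have hn : n = 0 := by omega
      subst hn
      have h1 : a = 1 := by norm_num at ha; omega
      have h2 : b = 0 := by norm_num at hb; omega
      subst h1 h2
      exact ⟨0, charpoly_Lmat_zero j⟩
    | 1, _, h, _ => exact absurd rfl h
    | 2, _, _, hn =>
      have hn : n = 1 := by omega
      subst hn
      have h1 : a = 0 := by norm_num at ha; omega
      have h2 : b = 1 := by norm_num at hb; omega
      subst h1 h2
      exact ⟨1, charpoly_Lmat_two j hj⟩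
    | N + 3, ih, hN3, hn =>
      obtain ⟨k, rfl⟩ : ∃ k, n = k + 1 := ⟨(N + 2) / 3, by omega⟩
      rw [pow_succ, pow_succ] at ha hb
      obtain ⟨b', rfl⟩ : ∃ b', a = 2 * b' := ⟨a / 2, by omega⟩
      obtain ⟨a', ha'⟩ : ∃ a' : ℕ, b = a' + b' := by
        refine ⟨b - b', ?_⟩
        rcases neg_one_pow_eq_or ℤ k with h | h <;> rw [h] at ha hb
        · have : (0 : ℤ) < 2 ^ k := by positivity
          omega
        · rcases Nat.eq_zero_or_pos k with rfl | hk
          · norm_num at h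
          · have h2 : (2 : ℤ) ^ 1 ≤ 2 ^ k := pow_le_pow_right₀ (by norm_num) hk
            omega
      subst ha'
      push_cast at ha hb
      obtain ⟨e, he⟩ := ih N (by omega) (by omega) k a' b' (by omega) (by linarith) (by linarith)
      exact Lmat_step N j hj e a' b' he

theorem natDegree_aux (r s t : ℂ) (e a b c : ℕ) :
    (X ^ e * (X - C r) ^ a * (X - C s) ^ b * (X - C t) ^ c : ℂ[X]).natDegree = e + a + b + c := by
  have h0 : (X ^ e : ℂ[X]).Monic := monic_X_pow e
  have h1 : ((X - C r) ^ a).Monic := (monic_X_sub_C r).pow a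
  have h2 : ((X - C s) ^ b).Monic := (monic_X_sub_C s).pow b
  have h3 : ((X - C t) ^ c).Monic := (monic_X_sub_C t).pow c
  rw [((h0.mul h1).mul h2).natDegree_mul h3, (h0.mul h1).natDegree_mul h2, h0.natDegree_mul h1]
  simp only [natDegree_pow, natDegree_X, natDegree_X_sub_C, mul_one]

/-- For `N ≢ 1 (mod 3)`, with `n = ⌈N/3⌉` and `j = e^(2iπ/3)`, the characteristic
polynomial of `𝕃_N` is `X^(F_{N+1}-2^n) (X-1)^a (X-j)^b (X-j²)^b`, where
`a = (2^n+2(-1)^n)/3` and `b = (2^n-(-1)^n)/3`. -/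
theorem Lmat_charpoly (N : ℕ) (hN : 1 ≤ N) (hN3 : N % 3 ≠ 1) (n a b : ℕ)
    (hn : n = (N + 2) / 3)
    (ha : (3 * a : ℤ) = 2 ^ n + 2 * (-1) ^ n)
    (hb : (3 * b : ℤ) = 2 ^ n - (-1) ^ n) :
    (Lmat N).charpoly =
      X ^ (F (N + 1) - 2 ^ n) * (X - C 1) ^ a
        * (X - C (Complex.exp (2 * Real.pi * Complex.I / 3))) ^ b
        * (X - C ((Complex.exp (2 * Real.pi * Complex.I / 3)) ^ 2)) ^ b := by
  have hj : IsPrimitiveRoot (Complex.exp (2 * Real.pi * Complex.I / 3)) 3 := by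
    simpa using Complex.isPrimitiveRoot_exp 3 (by norm_num)
  obtain ⟨e, he⟩ := Lmat_exists _ hj N hN3 n a b hn ha hb
  have hdeg : e + a + b + b = F (N + 1) := by
    rw [← card_pathIndep, ← Matrix.charpoly_natDegree_eq_dim (Lmat N), he, natDegree_aux]
  have hab : a + b + b = 2 ^ n := by
    have : (a + b + b : ℤ) = 2 ^ n := by linarith
    exact_mod_cast this
  have hee : e = F (N + 1) - 2 ^ n := by omega
  rw [he, hee]
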